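/- Let T be a finite tree on at least 2 vertices, let U be a nonempty subset of the vertices {1,…,|T|} of T, and let d = Σ_{i∈U} d_T(i). Then P(Σ_{i∈U} D_i(T) > t) ∼ c(|T|, d) · t^{1−2|T|+2d} · exp(−t²/4) as t → ∞, where c(a,b) = Γ(2a−2) / (2^{b−1} Γ(a−1/2) Γ(b)) and f(t) ∼ g(t) means f(t)/g(t) → 1. -/

import Mathlib

open MeasureTheory Filter Real
open scoped ENNReal

noncomputable section

/-- The degree of vertex `v` in a graph on `ℕ`. -/
def degN (G : SimpleGraph ℕ) (v : ℕ) : ℕ := (G.neighborSet v).ncard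

/-- `G` is a tree on the vertex set `{0, …, k-1}` (all other vertices isolated). -/
def IsTreeOn (k : ℕ) (G : SimpleGraph ℕ) : Prop :=
  (∀ v w : ℕ, G.Adj v w → v < k ∧ w < k) ∧ (G.induce {v : ℕ | v < k}).IsTree

instance : MeasurableSpace (SimpleGraph ℕ) := ⊤

/-- Add the edge `uv` to `G`. -/
def addEdge (G : SimpleGraph ℕ) (u v : ℕ) : SimpleGraph ℕ :=
  G ⊔ SimpleGraph.fromEdgeSet {s(u, v)}

/-- One step of preferential attachment: the current graph has `n` vertices `0, …, n-1`;
the new vertex `n` attaches to an existing vertex `v` with probability `deg v / (2(n-1))`. -/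
def paStep (n : ℕ) (G : SimpleGraph ℕ) : Measure (SimpleGraph ℕ) :=
  Measure.sum fun v : ℕ =>
    ((degN G v : ℝ≥0∞) / ((2 * (n - 1) : ℕ) : ℝ≥0∞)) • Measure.dirac (addEdge G n v)

def PAlawAux (k : ℕ) (T : SimpleGraph ℕ) : ℕ → Measure (SimpleGraph ℕ)
  | 0 => Measure.dirac T
  | m + 1 => (PAlawAux k T m).bind (paStep (k + m))

/-- The law of `PA(n, T)` for a seed tree `T` on `k` vertices, as a measure on labelled
graphs on `ℕ` (vertices are labelled `0, 1, 2, …` in order of arrival). -/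
def PAlaw (k : ℕ) (T : SimpleGraph ℕ) (n : ℕ) : Measure (SimpleGraph ℕ) :=
  PAlawAux k T (n - k)

/-- Graphs on `ℕ` up to isomorphism. -/
def graphSetoid : Setoid (SimpleGraph ℕ) where
  r G H := Nonempty (G ≃g H)
  iseqv := ⟨fun G => ⟨RelIso.refl G.Adj⟩, fun ⟨e⟩ => ⟨e.symm⟩, fun ⟨e⟩ ⟨f⟩ => ⟨e.trans f⟩⟩

/-- Isomorphism types of graphs on `ℕ`. -/
def GraphType : Type := Quotient graphSetoid

instance : MeasurableSpace GraphType := ⊤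

/-- The law of the isomorphism type of `PA(n, T)`. -/
def PAtype (k : ℕ) (T : SimpleGraph ℕ) (n : ℕ) : Measure GraphType :=
  (PAlaw k T n).map (Quotient.mk graphSetoid)

/-- Total variation distance between two measures. -/
def tvDist {α : Type*} [MeasurableSpace α] (μ ν : Measure α) : ℝ :=
  ⨆ A : Set α, |(μ A).toReal - (ν A).toReal|

/-- `δ(S, T) = lim_n TV(PA(n,S), PA(n,T))`, the total variation distance being taken
between the laws of the isomorphism types.  The limit exists since the sequence is
non-increasing; we express it as a `limsup`, which agrees with the limit. -/
def deltaPA (kS : ℕ) (S : SimpleGraph ℕ) (kT : ℕ) (T : SimpleGraph ℕ) : ℝ :=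
  Filter.limsup (fun n : ℕ => tvDist (PAtype kS S n) (PAtype kT T n)) Filter.atTop


/-- The constant `c(a,b) = Γ(2a-2) / (2^(b-1) Γ(a-1/2) Γ(b))`. -/
def cconst (a b : ℝ) : ℝ :=
  Real.Gamma (2 * a - 2) / ((2 : ℝ) ^ (b - 1) * Real.Gamma (a - 1 / 2) * Real.Gamma b)

theorem hasSum_charFun_of_summable_moments {μ : Measure ℝ} (hμ : ∀ᵐ x ∂μ, 0 ≤ x)
    (hInt : ∀ r : ℕ, Integrable (fun x : ℝ => x ^ r) μ)
    (hsum : ∀ s : ℝ, 0 ≤ s → Summable fun r : ℕ => s ^ r / (r.factorial : ℝ) * ∫ x, x ^ r ∂μ)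
    (t : ℝ) :
    HasSum (fun r : ℕ => ((t : ℂ) * Complex.I) ^ r / (r.factorial : ℂ) * ((∫ x, x ^ r ∂μ : ℝ) : ℂ))
      (charFun μ t) := by
  have hF : ∀ r : ℕ, Integrable
      (fun x : ℝ => ((t : ℂ) * Complex.I) ^ r / (r.factorial : ℂ) * ((x ^ r : ℝ) : ℂ)) μ :=
    fun r => ((hInt r).ofReal (𝕜 := ℂ)).const_mul _
  have hS : Summable fun r : ℕ =>
      ∫ x : ℝ, ‖((t : ℂ) * Complex.I) ^ r / (r.factorial : ℂ) * ((x ^ r : ℝ) : ℂ)‖ ∂μ := by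
    refine (hsum |t| (abs_nonneg t)).congr fun r => ?_
    rw [← integral_const_mul]
    refine integral_congr_ae ?_
    filter_upwards [hμ] with x hx
    simp [abs_of_nonneg hx]
  have h := hasSum_integral_of_summable_integral_norm hF hS
  convert! h using 1
  · ext r
    rw [integral_const_mul, integral_complex_ofReal]
  · rw [charFun_apply_real]
    refine integral_congr_ae (Eventually.of_forall fun x => ?_)
    dsimp only
    rw [Complex.exp_eq_exp_ℂ, NormedSpace.exp_eq_tsum_div]
    refine tsum_congr fun r => ?_
    push_cast
    ring

theorem integrable_pow_of_integrable_exp {ν : Measure ℝ} (hν : ∀ᵐ x ∂ν, 0 ≤ x)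
    (hexp : ∀ s : ℝ, Integrable (fun x : ℝ => exp (s * x)) ν) (r : ℕ) :
    Integrable (fun x : ℝ => x ^ r) ν := by
  refine ((hexp 1).const_mul (r.factorial : ℝ)).mono' (by fun_prop) ?_
  filter_upwards [hν] with x hx
  have h := Real.pow_div_factorial_le_exp x hx r
  rw [div_le_iff₀ (by positivity)] at h
  rw [Real.norm_of_nonneg (by positivity), one_mul, mul_comm]
  exact h

theorem summable_moments_of_integrable_exp {ν : Measure ℝ} (hν : ∀ᵐ x ∂ν, 0 ≤ x)
    (hexp : ∀ s : ℝ, Integrable (fun x : ℝ => exp (s * x)) ν) (s : ℝ) (hs : 0 ≤ s) :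
    Summable fun r : ℕ => s ^ r / (r.factorial : ℝ) * ∫ x, x ^ r ∂ν := by
  refine summable_of_sum_range_le (c := ∫ x, exp (s * x) ∂ν) (fun r => ?_) fun n => ?_
  · exact mul_nonneg (by positivity)
      (integral_nonneg_of_ae (by filter_upwards [hν] with x hx using pow_nonneg hx r))
  · simp_rw [← integral_const_mul]
    rw [← integral_finsetSum _ fun r _ =>
      (integrable_pow_of_integrable_exp hν hexp r).const_mul _]
    refine integral_mono_ae (integrable_finsetSum _ fun r _ =>
      (integrable_pow_of_integrable_exp hν hexp r).const_mul _) (hexp s) ?_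
    filter_upwards [hν] with x hx
    refine le_trans (le_of_eq ?_) (Real.sum_le_exp_of_nonneg (mul_nonneg hs hx) n)
    refine Finset.sum_congr rfl fun r _ => ?_
    rw [mul_pow]; ring

/-- A probability measure on `[0, ∞)` with all exponential moments is determined by its moments. -/
theorem measure_eq_of_moments_eq {μ ν : Measure ℝ} [IsProbabilityMeasure μ]
    [IsProbabilityMeasure ν] (hμ : ∀ᵐ x ∂μ, 0 ≤ x) (hν : ∀ᵐ x ∂ν, 0 ≤ x)
    (hInt : ∀ r : ℕ, Integrable (fun x : ℝ => x ^ r) μ)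
    (hexp : ∀ s : ℝ, Integrable (fun x : ℝ => exp (s * x)) ν)
    (hmom : ∀ r : ℕ, ∫ x, x ^ r ∂μ = ∫ x, x ^ r ∂ν) : μ = ν := by
  refine Measure.ext_of_charFun (funext fun t => ?_)
  have hsum := summable_moments_of_integrable_exp hν hexp
  refine (hasSum_charFun_of_summable_moments hμ hInt ?_ t).unique ?_
  · simpa only [hmom] using hsum
  · simpa only [hmom] using hasSum_charFun_of_summable_moments hν
      (integrable_pow_of_integrable_exp hν hexp) hsum t

/-- Almost sure convergence of a sequence bounded in `L²` implies convergence of the means. -/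
theorem tendsto_integral_of_ae_tendsto_of_sq_bounded {Ω : Type*} [MeasurableSpace Ω]
    {P : Measure Ω} [IsFiniteMeasure P] {f : ℕ → Ω → ℝ} {g : Ω → ℝ} {C : ℝ}
    (hf : ∀ n, AEMeasurable (f n) P) (hsq : ∀ n, Integrable (fun ω => f n ω ^ 2) P)
    (hC : ∀ n, ∫ ω, f n ω ^ 2 ∂P ≤ C)
    (hfg : ∀ᵐ ω ∂P, Tendsto (fun n => f n ω) atTop (nhds (g ω))) :
    Integrable g P ∧ Tendsto (fun n => ∫ ω, f n ω ∂P) atTop (nhds (∫ ω, g ω ∂P)) := by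
  have hfm : ∀ n, AEStronglyMeasurable (f n) P := fun n => (hf n).aestronglyMeasurable
  have hUI : UniformIntegrable f 1 P := by
    refine uniformIntegrable_of le_rfl ENNReal.one_ne_top hfm fun ε hε => ?_
    have hC0 : 0 ≤ C := (integral_nonneg fun ω => sq_nonneg (f 0 ω)).trans (hC 0)
    have hK : 0 < C / ε + 1 := by positivity
    refine ⟨⟨C / ε + 1, hK.le⟩, fun n => ?_⟩
    rw [eLpNorm_one_eq_lintegral_enorm]
    have hle : ∀ ω, ‖{x | (⟨C / ε + 1, hK.le⟩ : NNReal) ≤ ‖f n x‖₊}.indicator (f n) ω‖ₑ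
        ≤ ENNReal.ofReal (f n ω ^ 2 / (C / ε + 1)) := by
      intro ω
      by_cases h : (⟨C / ε + 1, hK.le⟩ : NNReal) ≤ ‖f n ω‖₊
      · rw [Set.indicator_of_mem (by exact h), ← ofReal_norm]
        refine ENNReal.ofReal_le_ofReal ?_
        rw [le_div_iff₀ hK, ← sq_abs, sq, Real.norm_eq_abs]
        exact mul_le_mul_of_nonneg_left (by exact_mod_cast h) (abs_nonneg _)
      · rw [Set.indicator_of_notMem (by exact h)]
        simp
    refine (lintegral_mono hle).trans ?_
    rw [← ofReal_integral_eq_lintegral_ofReal ((hsq n).div_const _)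
      (Eventually.of_forall fun ω => by positivity), integral_div]
    refine ENNReal.ofReal_le_ofReal ?_
    rw [div_le_iff₀ hK]
    have : ε * (C / ε + 1) = C + ε := by field_simp
    linarith [hC n]
  have hg : MemLp g 1 P := hUI.memLp_of_ae_tendsto hfg
  refine ⟨memLp_one_iff_integrable.1 hg, ?_⟩
  refine tendsto_integral_of_L1' g hg.aestronglyMeasurable
    (Eventually.of_forall fun n => memLp_one_iff_integrable.1 (hUI.memLp n)) ?_
  exact tendsto_Lp_finite_of_tendsto_ae le_rfl ENNReal.one_ne_top hfm hg hUI.unifIntegrable hfg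

/-- If `F ∼ h` at infinity and `-h` is the derivative of a function `H` vanishing at infinity, then
`∫_t^∞ F ∼ H(t)`. -/
theorem tendsto_integral_Ioi_div {F H h : ℝ → ℝ}
    (hH : ∀ᶠ t in atTop, HasDerivAt H (-h t) t) (hh : ∀ᶠ t in atTop, 0 < h t)
    (hHpos : ∀ᶠ t in atTop, 0 < H t) (hH0 : Tendsto H atTop (nhds 0)) (hF : Measurable F)
    (hFh : Tendsto (fun t => F t / h t) atTop (nhds 1)) :
    Tendsto (fun t => (∫ s in Set.Ioi t, F s) / H t) atTop (nhds 1) := by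
  rw [Metric.tendsto_atTop]
  intro ε hε
  have hclose : ∀ᶠ t in atTop, |F t / h t - 1| < ε / 2 := by
    have := Metric.tendsto_nhds.1 hFh (ε / 2) (by positivity)
    simpa only [Real.dist_eq] using this
  obtain ⟨a, ha⟩ := eventually_atTop.1 (hH.and (hh.and (hHpos.and hclose)))
  refine ⟨a, fun t hat => ?_⟩
  have hder : ∀ x ∈ Set.Ici t, HasDerivAt H (-h x) x := fun x hx => (ha x (hat.trans hx)).1
  have hneg : ∀ x ∈ Set.Ioi t, -h x ≤ 0 := fun x hx =>
    neg_nonpos.2 (ha x (hat.trans (le_of_lt hx))).2.1.le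
  have hInt : IntegrableOn h (Set.Ioi t) := by
    simpa using! (integrableOn_Ioi_deriv_of_nonpos' hder hneg hH0).neg
  have hval : ∫ s in Set.Ioi t, h s = H t := by
    have := integral_Ioi_of_hasDerivAt_of_nonpos' hder hneg hH0
    rw [integral_neg] at this
    linarith
  have hHt := (ha t hat).2.2.1
  have hbound : ∀ s ∈ Set.Ioi t, |F s - h s| ≤ ε / 2 * h s := by
    intro s hs
    obtain ⟨-, h1, -, h2⟩ := ha s (hat.trans (le_of_lt hs))
    have : F s - h s = (F s / h s - 1) * h s := by field_simp
    rw [this, abs_mul, abs_of_pos h1]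
    exact mul_le_mul_of_nonneg_right h2.le h1.le
  have hdiff : IntegrableOn (fun s => F s - h s) (Set.Ioi t) :=
    (hInt.const_mul (ε / 2)).mono' (hF.aestronglyMeasurable.sub hInt.aestronglyMeasurable)
      ((ae_restrict_iff' measurableSet_Ioi).2 (Eventually.of_forall hbound))
  have hFint : IntegrableOn F (Set.Ioi t) := by
    exact (hdiff.add hInt).congr_fun (fun s _ => by simp) measurableSet_Ioi
  have hle : |(∫ s in Set.Ioi t, F s) - H t| ≤ ε / 2 * H t := by
    rw [← hval, ← integral_sub hFint hInt, ← integral_const_mul]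
    exact norm_integral_le_of_norm_le (f := fun s => F s - h s) (hInt.const_mul (ε / 2))
      ((ae_restrict_iff' measurableSet_Ioi).2 (Eventually.of_forall hbound))
  rw [Real.dist_eq, div_sub_one hHt.ne', abs_div, abs_of_pos hHt, div_lt_iff₀ hHt]
  nlinarith

theorem tendsto_rpow_mul_exp_neg_sq_div_four (q : ℝ) :
    Tendsto (fun t : ℝ => t ^ q * exp (-t ^ 2 / 4)) atTop (nhds 0) := by
  have h := (rpow_mul_exp_neg_mul_sq_isLittleO_exp_neg (b := 1 / 4) (by norm_num) q)
  have h0 : Tendsto (fun x : ℝ => exp (-(1 / 2) * x)) atTop (nhds 0) :=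
    tendsto_exp_atBot.comp (tendsto_id.const_mul_atTop_of_neg (by norm_num))
  refine (h.trans_tendsto h0).congr fun t => ?_
  ring_nf

/-- Tail integrals of functions asymptotic to `c s^q exp(-s²/4)`. -/
theorem tendsto_integral_Ioi_div_rpow_mul_exp {F : ℝ → ℝ} {c q : ℝ} (hc : 0 < c)
    (hF : Measurable F)
    (hFq : Tendsto (fun t => F t / (c * t ^ q * exp (-t ^ 2 / 4))) atTop (nhds 1)) :
    Tendsto (fun t => (∫ s in Set.Ioi t, F s) / (2 * c * t ^ (q - 1) * exp (-t ^ 2 / 4)))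
      atTop (nhds 1) := by
  have hcorr : Tendsto (fun t : ℝ => 1 - 2 * (q - 1) * (t ^ 2)⁻¹) atTop (nhds 1) := by
    have : Tendsto (fun t : ℝ => (t ^ 2)⁻¹) atTop (nhds 0) :=
      tendsto_inv_atTop_zero.comp (tendsto_pow_atTop two_ne_zero)
    simpa using (this.const_mul (2 * (q - 1))).const_sub 1
  refine tendsto_integral_Ioi_div
    (h := fun t => c * t ^ q * exp (-t ^ 2 / 4) * (1 - 2 * (q - 1) * (t ^ 2)⁻¹)) ?_ ?_ ?_ ?_ hF ?_
  · filter_upwards [eventually_gt_atTop 0] with t ht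
    have h1 : HasDerivAt (fun t : ℝ => t ^ (q - 1)) ((q - 1) * t ^ (q - 1 - 1)) t :=
      hasDerivAt_rpow_const (Or.inl ht.ne')
    have h2 : HasDerivAt (fun t : ℝ => exp (-t ^ 2 / 4)) (exp (-t ^ 2 / 4) * (-(2 * t) / 4)) t := by
      have := ((hasDerivAt_pow 2 t).neg.div_const 4).exp
      simpa using! this
    have h3 := (h1.const_mul (2 * c)).mul h2
    refine h3.congr_deriv ?_
    have e1 : t ^ q = t ^ (q - 1) * t := by
      rw [← rpow_add_one ht.ne']; ring_nf
    have e2 : t ^ (q - 1) = t ^ (q - 1 - 1) * t := by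
      rw [← rpow_add_one ht.ne']; ring_nf
    rw [e1, e2]
    field_simp
    ring
  · filter_upwards [eventually_gt_atTop 0, hcorr.eventually (lt_mem_nhds zero_lt_one)] with t ht h
    positivity
  · filter_upwards [eventually_gt_atTop 0] with t ht
    positivity
  · simpa [mul_assoc] using (tendsto_rpow_mul_exp_neg_sq_div_four (q - 1)).const_mul (2 * c)
  · have := hFq.div hcorr one_ne_zero
    rw [div_one] at this
    refine this.congr fun t => ?_
    simp only [Pi.div_apply]
    rw [div_div]

theorem cconst_pos {a b : ℝ} (ha : 1 < a) (hb : 0 < b) : 0 < cconst a b := by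
  unfold cconst
  have h1 := Gamma_pos_of_pos (s := 2 * a - 2) (by linarith)
  have h2 := Gamma_pos_of_pos (s := a - 1 / 2) (by linarith)
  have h3 := Gamma_pos_of_pos hb
  positivity

theorem cconst_eq_mul_cconst_add_one {a b : ℝ} (hb : 0 < b) :
    cconst a b = 2 * b * cconst a (b + 1) := by
  unfold cconst
  have h3 := Gamma_pos_of_pos hb
  have h4 : (2 : ℝ) ^ b = 2 ^ (b - 1) * 2 := by
    rw [← rpow_add_one two_ne_zero]; ring_nf
  rw [Gamma_add_one hb.ne', add_sub_cancel_right, h4]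
  rcases eq_or_ne (Gamma (a - 1 / 2)) 0 with h | h
  · rw [h]; simp
  · field_simp

/-- The `r`-th moment of the limit of `(∑_{i ∈ U} deg i) / √n` for preferential attachment started
from a tree on `k` vertices in which `U` has total degree `d`. -/
def limitMoment (k d r : ℕ) : ℝ :=
  Gamma (d + r) * Gamma ((k : ℝ) - 1) / (Gamma d * Gamma ((k : ℝ) - 1 + r / 2))

theorem limitMoment_eq_mul_limitMoment_succ {k d r : ℕ} (hd : 1 ≤ d) :
    limitMoment k d r = limitMoment k (d + 1) r * (d / (d + r)) := by
  unfold limitMoment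
  have h0 : (0 : ℝ) < d := by exact_mod_cast hd
  have h1 := Gamma_pos_of_pos h0
  have h2 : (0 : ℝ) < d + r := by positivity
  have e : ((d + 1 : ℕ) : ℝ) + r = (d + r) + 1 := by push_cast; ring
  rw [e, Gamma_add_one h2.ne', Nat.cast_add_one, Gamma_add_one h0.ne']
  rcases eq_or_ne (Gamma ((k : ℝ) - 1 + r / 2)) 0 with h | h
  · simp [h]
  · field_simp

/-- The properties characterising the limit law of the rescaled total degree, together with its
tail asymptotics. -/
structure IsLimitLaw (k d : ℕ) (ν : Measure ℝ) : Prop where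
  prob : IsProbabilityMeasure ν
  nonneg : ∀ᵐ x ∂ν, 0 ≤ x
  integrable_exp : ∀ s : ℝ, Integrable (fun x : ℝ => exp (s * x)) ν
  integral_pow : ∀ r : ℕ, ∫ x, x ^ r ∂ν = limitMoment k d r
  tail : Tendsto (fun t : ℝ => ν.real (Set.Ioi t) /
    (cconst k d * t ^ ((1 : ℝ) - 2 * k + 2 * d) * exp (-t ^ 2 / 4))) atTop (nhds 1)

/-- The measure on `s` with density `g`. -/
def densityOn (g : ℝ → ℝ) (s : Set ℝ) : Measure ℝ :=
  (volume.restrict s).withDensity fun x => ENNReal.ofReal (g x)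

theorem integral_densityOn {g : ℝ → ℝ} {s : Set ℝ} (hs : MeasurableSet s) (hg : Measurable g)
    (hg0 : ∀ x ∈ s, 0 ≤ g x) (f : ℝ → ℝ) :
    ∫ x, f x ∂(densityOn g s) = ∫ x in s, g x * f x := by
  unfold densityOn
  rw [integral_withDensity_eq_integral_toReal_smul (by fun_prop)
    (Eventually.of_forall fun x => ENNReal.ofReal_lt_top)]
  refine setIntegral_congr_fun hs fun x hx => ?_
  simp [ENNReal.toReal_ofReal (hg0 x hx)]

theorem integrable_densityOn {g : ℝ → ℝ} {s : Set ℝ} (hs : MeasurableSet s) (hg : Measurable g)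
    (hg0 : ∀ x ∈ s, 0 ≤ g x) {f : ℝ → ℝ} (hf : IntegrableOn (fun x => g x * f x) s) :
    Integrable f (densityOn g s) := by
  unfold densityOn
  rw [integrable_withDensity_iff_integrable_smul' (by fun_prop)
    (Eventually.of_forall fun x => ENNReal.ofReal_lt_top)]
  refine (integrableOn_congr_fun (fun x hx => ?_) hs).1 hf
  simp [ENNReal.toReal_ofReal (hg0 x hx)]

theorem ae_densityOn_mem {g : ℝ → ℝ} {s : Set ℝ} (hs : MeasurableSet s) :
    ∀ᵐ x ∂(densityOn g s), x ∈ s :=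
  (withDensity_absolutelyContinuous _ _).ae_le (ae_restrict_mem hs)

theorem isProbabilityMeasure_densityOn {g : ℝ → ℝ} {s : Set ℝ} (hs : MeasurableSet s)
    (hg0 : ∀ x ∈ s, 0 ≤ g x) (hgi : IntegrableOn g s)
    (h1 : ∫ x in s, g x = 1) : IsProbabilityMeasure (densityOn g s) := by
  constructor
  unfold densityOn
  rw [withDensity_apply _ MeasurableSet.univ, Measure.restrict_univ,
    ← ofReal_integral_eq_lintegral_ofReal hgi
      ((ae_restrict_iff' hs).2 (Eventually.of_forall hg0)), h1, ENNReal.ofReal_one]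

theorem integral_pow_mul_exp_neg_sq_div_four (n : ℕ) :
    ∫ x in Set.Ioi (0 : ℝ), x ^ n * exp (-x ^ 2 / 4) = 2 ^ n * Gamma ((n + 1) / 2) := by
  have hn : (-1 : ℝ) < n := by
    have : (0 : ℝ) ≤ n := n.cast_nonneg
    linarith
  have h := integral_rpow_mul_exp_neg_mul_rpow (p := 2) (q := n) (b := 1 / 4) two_pos hn
    (by norm_num)
  have e : (1 / 4 : ℝ) ^ (-((n : ℝ) + 1) / 2) = 2 ^ (n + 1) := by
    rw [show (1 / 4 : ℝ) = 2 ^ (-2 : ℝ) by rw [rpow_neg two_pos.le]; norm_num,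
      ← rpow_mul two_pos.le, ← rpow_natCast]
    push_cast
    ring_nf
  rw [e] at h
  rw [show (2 : ℝ) ^ n * Gamma ((n + 1) / 2) = 2 ^ (n + 1) * (1 / 2) * Gamma ((n + 1) / 2) by
    ring, ← h]
  refine setIntegral_congr_fun measurableSet_Ioi fun x _ => ?_
  simp only [rpow_natCast, rpow_two]
  ring_nf

theorem integrableOn_pow_mul_exp_neg_mul_sq (n : ℕ) {b : ℝ} (hb : 0 < b) :
    IntegrableOn (fun x : ℝ => x ^ n * exp (-b * x ^ 2)) (Set.Ioi 0) := by
  have hn : (-1 : ℝ) < n := by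
    have : (0 : ℝ) ≤ n := n.cast_nonneg
    linarith
  simpa using integrableOn_rpow_mul_exp_neg_mul_sq hb hn

theorem exists_isLimitLaw_of_eq {k d : ℕ} (hk : 2 ≤ k) (hd : d = 2 * k - 2) :
    ∃ ν, IsLimitLaw k d ν := by
  have hdk : (d : ℝ) = 2 * k - 2 := by
    rw [hd, Nat.cast_sub (by omega)]; push_cast; ring
  have hk2 : (2 : ℝ) ≤ k := by exact_mod_cast hk
  have hd0 : (0 : ℝ) < d := by linarith
  have hG := Gamma_pos_of_pos (s := ((d : ℝ) + 1) / 2) (by linarith)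
  set c : ℝ := (2 ^ d * Gamma (((d : ℝ) + 1) / 2))⁻¹ with hc
  have hc0 : 0 < c := by positivity
  set g : ℝ → ℝ := fun x => c * (x ^ d * exp (-x ^ 2 / 4)) with hg
  have hgm : Measurable g := by fun_prop
  have hg0 : ∀ x ∈ Set.Ioi (0 : ℝ), 0 ≤ g x := fun x hx => by
    have : (0 : ℝ) < x := hx
    positivity
  have hgi : IntegrableOn g (Set.Ioi 0) := by
    refine IntegrableOn.congr_fun
      ((integrableOn_pow_mul_exp_neg_mul_sq d (b := 1 / 4) (by norm_num)).const_mul c)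
      (fun x _ => ?_) measurableSet_Ioi
    simp only [hg]
    ring_nf
  have hmom : ∀ r : ℕ, ∫ x, x ^ r ∂(densityOn g (Set.Ioi 0)) = limitMoment k d r := by
    intro r
    rw [integral_densityOn measurableSet_Ioi hgm hg0]
    have : ∀ x : ℝ, g x * x ^ r = c * (x ^ (d + r) * exp (-x ^ 2 / 4)) := fun x => by
      simp only [hg]; ring
    simp_rw [this]
    rw [integral_const_mul, integral_pow_mul_exp_neg_sq_div_four, hc, limitMoment,
      show (k : ℝ) - 1 = d / 2 by linarith]
    have hr : (0 : ℝ) ≤ r := r.cast_nonneg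
    have d1 := Real.Gamma_mul_Gamma_add_half ((d : ℝ) / 2)
    have d2 := Real.Gamma_mul_Gamma_add_half (((d : ℝ) + r) / 2)
    rw [← add_div, mul_div_cancel₀ _ two_ne_zero] at d1 d2
    have g1 := Gamma_pos_of_pos (s := (d : ℝ) / 2) (by positivity)
    have g2 := Gamma_pos_of_pos (s := (d : ℝ)) (by positivity)
    have g3 := Gamma_pos_of_pos (s := ((d : ℝ) + r) / 2) (by positivity)
    have g4 := Gamma_pos_of_pos (s := (d : ℝ) + r) (by positivity)
    have e : (2 : ℝ) ^ (1 - (d : ℝ)) = 2 ^ (1 - ((d : ℝ) + r)) * 2 ^ r := by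
      rw [← rpow_natCast 2 r, ← rpow_add two_pos]; ring_nf
    push_cast
    rw [← add_div, pow_add]
    rw [inv_mul_eq_div, div_eq_div_iff (by positivity) (by positivity)]
    rw [e] at d1
    linear_combination (2 ^ d * 2 ^ r * Gamma d) * d2 - (2 ^ d * Gamma (d + r)) * d1
  refine ⟨densityOn g (Set.Ioi 0), ?_, ?_, ?_, hmom, ?_⟩
  · refine isProbabilityMeasure_densityOn measurableSet_Ioi hg0 hgi ?_
    simp only [hg]
    rw [integral_const_mul, integral_pow_mul_exp_neg_sq_div_four, hc]
    field_simp
  · filter_upwards [ae_densityOn_mem measurableSet_Ioi] with x hx using le_of_lt hx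
  · intro s
    refine integrable_densityOn measurableSet_Ioi hgm hg0 ?_
    refine ((integrableOn_pow_mul_exp_neg_mul_sq d (b := 1 / 8) (by norm_num)).const_mul
      (c * exp (2 * s ^ 2))).mono' (by fun_prop) ?_
    refine (ae_restrict_iff' measurableSet_Ioi).2 (Eventually.of_forall fun x hx => ?_)
    have hx0 : (0 : ℝ) < x := hx
    rw [Real.norm_of_nonneg (by positivity)]
    have : exp (-x ^ 2 / 4) * exp (s * x) ≤ exp (2 * s ^ 2) * exp (-(1 / 8) * x ^ 2) := by
      rw [← exp_add, ← exp_add, exp_le_exp]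
      nlinarith [sq_nonneg (x - 4 * s)]
    calc g x * exp (s * x) = c * x ^ d * (exp (-x ^ 2 / 4) * exp (s * x)) := by
          simp only [hg]; ring
      _ ≤ c * x ^ d * (exp (2 * s ^ 2) * exp (-(1 / 8) * x ^ 2)) := by gcongr
      _ = _ := by ring
  · have h := tendsto_integral_Ioi_div_rpow_mul_exp (F := g) (q := d) hc0 hgm
      (tendsto_const_nhds.congr' (by
        filter_upwards [eventually_gt_atTop 0] with t ht
        rw [rpow_natCast, hg]
        field_simp))
    refine h.congr' ?_
    filter_upwards [eventually_gt_atTop 0] with t ht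
    have htail : (densityOn g (Set.Ioi 0)).real (Set.Ioi t) = ∫ s in Set.Ioi t, g s := by
      rw [Measure.real, densityOn, withDensity_apply _ measurableSet_Ioi,
        Measure.restrict_restrict measurableSet_Ioi, Set.Ioi_inter_Ioi, sup_eq_left.2 ht.le,
        ← ofReal_integral_eq_lintegral_ofReal (hgi.mono_set (Set.Ioi_subset_Ioi ht.le))
          ((ae_restrict_iff' measurableSet_Ioi).2
            (Eventually.of_forall fun x hx => hg0 x (ht.trans hx))),
        ENNReal.toReal_ofReal
          (setIntegral_nonneg measurableSet_Ioi fun x hx => hg0 x (ht.trans hx))]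
    have e1 : (1 : ℝ) - 2 * k + 2 * d = d - 1 := by linarith
    have e2 : cconst k d = 2 * c := by
      have g2 := Gamma_pos_of_pos hd0
      have : (2 : ℝ) ^ ((d : ℝ) - 1) = 2 ^ d / 2 := by
        rw [rpow_sub_one two_ne_zero, rpow_natCast]
      rw [cconst, show (2 * (k : ℝ) - 2) = d by linarith, this, hc,
        show (k : ℝ) - 1 / 2 = (d + 1) / 2 by linarith]
      field_simp
    rw [htail, e1, e2]

theorem integral_Ioi_one_mul_rpow {d : ℕ} (hd : 1 ≤ d) (r : ℕ) :
    ∫ w in Set.Ioi (1 : ℝ), d * w ^ (-(d : ℝ) - 1) * (w⁻¹) ^ r = d / (d + r) := by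
  have hd0 : (0 : ℝ) < d := by exact_mod_cast hd
  have hr : (0 : ℝ) ≤ r := r.cast_nonneg
  have : ∀ w ∈ Set.Ioi (1 : ℝ), d * w ^ (-(d : ℝ) - 1) * (w⁻¹) ^ r
      = d * w ^ (-((d : ℝ) + r) - 1) := by
    intro w hw
    have hw0 : (0 : ℝ) < w := lt_trans one_pos hw
    rw [inv_pow, ← rpow_natCast, ← rpow_neg hw0.le, mul_assoc, ← rpow_add hw0]
    ring_nf
  rw [setIntegral_congr_fun measurableSet_Ioi this, integral_const_mul,
    integral_Ioi_rpow_of_lt (by linarith) one_pos, one_rpow]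
  have : (d : ℝ) + r ≠ 0 := by positivity
  rw [sub_add_cancel]
  field_simp

theorem IsLimitLaw.exists_pred {k d : ℕ} (hk : 2 ≤ k) (hd : 1 ≤ d) {ν : Measure ℝ}
    (hν : IsLimitLaw k (d + 1) ν) : ∃ ν', IsLimitLaw k d ν' := by
  have := hν.prob
  have hd0 : (0 : ℝ) < d := by exact_mod_cast hd
  have hk2 : (2 : ℝ) ≤ k := by exact_mod_cast hk
  set g : ℝ → ℝ := fun w => d * w ^ (-(d : ℝ) - 1) with hg
  have hgm : Measurable g := by fun_prop
  have hg0 : ∀ w ∈ Set.Ioi (1 : ℝ), 0 ≤ g w := fun w hw => by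
    have : (0 : ℝ) < w := lt_trans one_pos hw
    positivity
  have hgi : IntegrableOn g (Set.Ioi 1) :=
    (integrableOn_Ioi_rpow_of_lt (by linarith) one_pos).const_mul _
  set κ := densityOn g (Set.Ioi 1) with hκ
  have hκp : IsProbabilityMeasure κ := by
    refine isProbabilityMeasure_densityOn measurableSet_Ioi hg0 hgi ?_
    have := integral_Ioi_one_mul_rpow hd 0
    simpa [hd0.ne', hg] using this
  have hκ1 : ∀ᵐ w ∂κ, 1 < w := ae_densityOn_mem measurableSet_Ioi
  have hm : Measurable fun p : ℝ × ℝ => p.1 / p.2 := by fun_prop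
  have hfst : ∀ᵐ p ∂(ν.prod κ), 0 ≤ p.1 := Measure.quasiMeasurePreserving_fst.ae hν.nonneg
  have hsnd : ∀ᵐ p ∂(ν.prod κ), 1 < p.2 := Measure.quasiMeasurePreserving_snd.ae hκ1
  have hFm : Measurable fun s : ℝ => ν.real (Set.Ioi s) :=
    Antitone.measurable fun a b hab => measureReal_mono (Set.Ioi_subset_Ioi hab)
  refine ⟨(ν.prod κ).map fun p => p.1 / p.2, ?_, ?_, ?_, ?_, ?_⟩
  · exact Measure.isProbabilityMeasure_map hm.aemeasurable
  · rw [ae_map_iff hm.aemeasurable measurableSet_Ici]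
    filter_upwards [hfst, hsnd] with p h1 h2
    have : (0 : ℝ) < p.2 := one_pos.trans h2
    positivity
  · intro s
    rw [integrable_map_measure (by fun_prop) hm.aemeasurable]
    refine ((hν.integrable_exp |s|).comp_fst κ).mono' (by fun_prop) ?_
    filter_upwards [hfst, hsnd] with p h1 h2
    rw [Function.comp_apply, Real.norm_of_nonneg (exp_pos _).le, exp_le_exp]
    exact mul_le_mul (le_abs_self s) (div_le_self h1 h2.le)
      (div_nonneg h1 (one_pos.trans h2).le) (abs_nonneg s)
  · intro r
    rw [integral_map hm.aemeasurable (by fun_prop)]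
    simp_rw [div_eq_mul_inv, mul_pow]
    rw [integral_prod_mul (fun x : ℝ => x ^ r) fun w : ℝ => w⁻¹ ^ r, hν.integral_pow,
      integral_densityOn measurableSet_Ioi hgm hg0, integral_Ioi_one_mul_rpow hd r,
      limitMoment_eq_mul_limitMoment_succ hd]
  · set F : ℝ → ℝ := fun s => g s * ν.real (Set.Ioi s) with hF
    set c : ℝ := cconst k ((d + 1 : ℕ) : ℝ) with hc
    have hc0 : 0 < c := cconst_pos (by linarith) (by positivity)
    set p : ℝ := 1 - 2 * k + 2 * ((d + 1 : ℕ) : ℝ) with hp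
    have hasymp := tendsto_integral_Ioi_div_rpow_mul_exp (F := F) (c := d * c)
      (q := p - d - 1) (by positivity) (hgm.mul hFm) (by
        refine hν.tail.congr' ?_
        filter_upwards [eventually_gt_atTop 0] with t ht
        have e : t ^ (p - d - 1) = t ^ p * t ^ (-(d : ℝ) - 1) := by
          rw [← rpow_add ht]; ring_nf
        have : 0 < t ^ p := by positivity
        have : 0 < t ^ (-(d : ℝ) - 1) := by positivity
        simp only [hF, hg]
        rw [e, ← hc, ← hp]
        field_simp)
    refine hasymp.congr' ?_
    filter_upwards [eventually_gt_atTop 0] with t ht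
    have htail : ((ν.prod κ).map fun p => p.1 / p.2).real (Set.Ioi t)
        = t ^ d * ∫ s in Set.Ioi t, F s := by
      rw [map_measureReal_apply hm measurableSet_Ioi, Measure.real,
        Measure.prod_apply_symm (hm measurableSet_Ioi)]
      have h1 : ∫⁻ w, ν ((fun x => (x, w)) ⁻¹' ((fun p : ℝ × ℝ => p.1 / p.2) ⁻¹' Set.Ioi t)) ∂κ
          = ∫⁻ w, ν (Set.Ioi (t * w)) ∂κ := by
        refine lintegral_congr_ae ?_
        filter_upwards [hκ1] with w hw
        congr 1
        ext x
        simp [lt_div_iff₀ (one_pos.trans hw)]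
      have hνm : Measurable fun s : ℝ => ν (Set.Ioi s) :=
        Antitone.measurable fun a b hab => measure_mono (Set.Ioi_subset_Ioi hab)
      rw [h1, ← integral_toReal (f := fun w => ν (Set.Ioi (t * w)))
        (hνm.comp (measurable_const_mul t)).aemeasurable
        (Eventually.of_forall fun w => measure_lt_top ν _)]
      rw [integral_densityOn measurableSet_Ioi hgm hg0]
      have h2 := integral_comp_mul_left_Ioi F 1 ht
      rw [mul_one, smul_eq_mul] at h2
      have h3 : ∀ w ∈ Set.Ioi (1 : ℝ),
          g w * (ν (Set.Ioi (t * w))).toReal = t ^ (d + 1) * F (t * w) := by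
        intro w hw
        have hw0 : (0 : ℝ) < w := lt_trans one_pos hw
        have e : t ^ (d + 1) * t ^ (-(d : ℝ) - 1) = 1 := by
          rw [← rpow_natCast, ← rpow_add ht]
          push_cast
          rw [show (d : ℝ) + 1 + (-d - 1) = 0 by ring, rpow_zero]
        simp only [hF, hg]
        rw [mul_rpow ht.le hw0.le]
        calc _ = (t ^ (d + 1) * t ^ (-(d : ℝ) - 1)) *
              (d * w ^ (-(d : ℝ) - 1) * (ν (Set.Ioi (t * w))).toReal) := by rw [e, one_mul]
          _ = _ := by rw [Measure.real]; ring
      rw [setIntegral_congr_fun measurableSet_Ioi h3, integral_const_mul, h2]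
      field_simp
      ring
    have e1 : t ^ ((1 : ℝ) - 2 * k + 2 * d) = t ^ d * t ^ (p - d - 1 - 1) := by
      rw [← rpow_natCast, ← rpow_add ht, hp]
      push_cast
      ring_nf
    have e2 : cconst k d = 2 * (d * c) := by
      rw [cconst_eq_mul_cconst_add_one hd0, hc]
      push_cast
      ring
    rw [htail, e1, e2]
    have : 0 < t ^ d := by positivity
    have : 0 < t ^ (p - d - 1 - 1) := by positivity
    field_simp

theorem exists_isLimitLaw {k d : ℕ} (hk : 2 ≤ k) (hd : 1 ≤ d) (hdk : d ≤ 2 * k - 2) :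
    ∃ ν, IsLimitLaw k d ν := by
  induction hdk using Nat.decreasingInduction with
  | self => exact exists_isLimitLaw_of_eq hk rfl
  | of_succ d _ ih =>
    obtain ⟨ν, hν⟩ := ih (by omega)
    exact hν.exists_pred hk hd

theorem degN_eq_zero_of_forall_not_adj {G : SimpleGraph ℕ} {v : ℕ} (h : ∀ w, ¬ G.Adj v w) :
    degN G v = 0 := by
  have : G.neighborSet v = ∅ := Set.eq_empty_iff_forall_notMem.2 h
  rw [degN, this, Set.ncard_empty]

/-- `G` lives on the vertices `0, …, n-1` and has the total degree of a tree on them. -/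
structure HasTreeDegrees (n : ℕ) (G : SimpleGraph ℕ) : Prop where
  lt_of_adj : ∀ v w : ℕ, G.Adj v w → v < n ∧ w < n
  sum_degN : ∑ v ∈ Finset.range n, degN G v = 2 * (n - 1)

namespace HasTreeDegrees

variable {n : ℕ} {G : SimpleGraph ℕ}

theorem finite_neighborSet (h : HasTreeDegrees n G) (v : ℕ) : (G.neighborSet v).Finite :=
  (Set.finite_Iio n).subset fun _ hw => (h.lt_of_adj _ _ hw).2

theorem degN_eq_zero (h : HasTreeDegrees n G) {v : ℕ} (hv : n ≤ v) : degN G v = 0 :=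
  degN_eq_zero_of_forall_not_adj fun _ hw => absurd (h.lt_of_adj _ _ hw).1 (not_lt.2 hv)

theorem addEdge_adj {n v : ℕ} (hv : v ≠ n) (x y : ℕ) :
    (addEdge G n v).Adj x y ↔ G.Adj x y ∨ (x = n ∧ y = v) ∨ (x = v ∧ y = n) := by
  simp only [addEdge, SimpleGraph.sup_adj, SimpleGraph.fromEdgeSet_adj, Set.mem_singleton_iff,
    Sym2.eq_iff]
  grind

theorem degN_addEdge (h : HasTreeDegrees n G) {v : ℕ} (hv : v < n) (w : ℕ) :
    degN (addEdge G n v) w = degN G w + if w = v ∨ w = n then 1 else 0 := by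
  have hadj := addEdge_adj (G := G) hv.ne
  have hn : ∀ x, ¬ G.Adj x n := fun x hx => lt_irrefl _ (h.lt_of_adj _ _ hx).2
  have hn' : ∀ x, ¬ G.Adj n x := fun x hx => lt_irrefl _ (h.lt_of_adj _ _ hx).1
  unfold degN
  by_cases hwv : w = v
  · have : (addEdge G n v).neighborSet w = insert n (G.neighborSet w) := by
      ext x
      simp only [SimpleGraph.mem_neighborSet, hadj, Set.mem_insert_iff]
      grind
    rw [this, Set.ncard_insert_of_notMem (s := G.neighborSet w) (hn w) (h.finite_neighborSet w),
        if_pos (Or.inl hwv)]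
  · by_cases hwn : w = n
    · have : (addEdge G n v).neighborSet w = insert v (G.neighborSet w) := by
        ext x
        simp only [SimpleGraph.mem_neighborSet, hadj, Set.mem_insert_iff]
        grind
      rw [this, Set.ncard_insert_of_notMem (s := G.neighborSet w)
        (by subst hwn; exact hn' v) (h.finite_neighborSet w), if_pos (Or.inr hwn)]
    · have : (addEdge G n v).neighborSet w = G.neighborSet w := by
        ext x
        simp only [SimpleGraph.mem_neighborSet, hadj]
        grind
      rw [this, if_neg (by tauto), add_zero]

theorem addEdge (h : HasTreeDegrees n G) {v : ℕ} (hv : v < n) :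
    HasTreeDegrees (n + 1) (addEdge G n v) := by
  refine ⟨fun x y hxy => ?_, ?_⟩
  · rcases (addEdge_adj hv.ne x y).1 hxy with hG | ⟨rfl, rfl⟩ | ⟨rfl, rfl⟩
    · have := h.lt_of_adj _ _ hG
      omega
    · omega
    · omega
  · simp_rw [h.degN_addEdge hv]
    have hsum : ∑ w ∈ Finset.range n, (if w = v ∨ w = n then 1 else 0) = 1 := by
      rw [Finset.sum_eq_single v]
      · simp
      · intro w hw hwv
        have := Finset.mem_range.1 hw
        rw [if_neg (by omega)]
      · intro h; exact absurd (Finset.mem_range.2 hv) h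
    rw [Finset.sum_range_succ, Finset.sum_add_distrib, h.sum_degN, hsum, h.degN_eq_zero le_rfl,
      if_pos (Or.inr rfl)]
    omega

theorem lintegral_paStep (h : HasTreeDegrees n G) (f : SimpleGraph ℕ → ℝ≥0∞) :
    ∫⁻ G', f G' ∂(paStep n G) = ∑ v ∈ Finset.range n,
      (degN G v : ℝ≥0∞) / ((2 * (n - 1) : ℕ) : ℝ≥0∞) * f (_root_.addEdge G n v) := by
  rw [paStep, lintegral_sum_measure, tsum_eq_sum (s := Finset.range n)]
  · refine Finset.sum_congr rfl fun v _ => ?_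
    rw [lintegral_smul_measure, lintegral_dirac' _ measurable_from_top, smul_eq_mul]
  · intro v hv
    rw [h.degN_eq_zero (by simpa using hv)]
    simp

theorem sum_degN_addEdge (h : HasTreeDegrees n G) {U : Finset ℕ} (hU : U ⊆ Finset.range n)
    {v : ℕ} (hv : v < n) :
    ∑ i ∈ U, degN (_root_.addEdge G n v) i = ∑ i ∈ U, degN G i + if v ∈ U then 1 else 0 := by
  simp_rw [h.degN_addEdge hv, Finset.sum_add_distrib]
  congr 1
  rw [← Finset.sum_ite_eq' U v fun _ => 1]
  refine Finset.sum_congr rfl fun w hw => ?_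
  have := Finset.mem_range.1 (hU hw)
  simp [this.ne]

theorem lintegral_ascFactorial_paStep (h : HasTreeDegrees n G) {U : Finset ℕ}
    (hU : U ⊆ Finset.range n) (r : ℕ) :
    ∫⁻ G', (((∑ i ∈ U, degN G' i).ascFactorial r : ℕ) : ℝ≥0∞) ∂(paStep n G)
      = (((∑ i ∈ U, degN G i).ascFactorial r : ℕ) : ℝ≥0∞) *
        (((2 * (n - 1) + r : ℕ) : ℝ≥0∞) / ((2 * (n - 1) : ℕ) : ℝ≥0∞)) := by
  rw [h.lintegral_paStep]
  set S := ∑ i ∈ U, degN G i with hS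
  have hnat : ∑ v ∈ Finset.range n, degN G v * (S + if v ∈ U then 1 else 0).ascFactorial r
      = S.ascFactorial r * (2 * (n - 1) + r) := by
    have hsplit := Finset.sum_sdiff (f := degN G) hU
    rw [h.sum_degN] at hsplit
    rw [← Finset.sum_sdiff hU]
    have h1 : ∑ v ∈ Finset.range n \ U, degN G v * (S + if v ∈ U then 1 else 0).ascFactorial r
        = (∑ v ∈ Finset.range n \ U, degN G v) * S.ascFactorial r := by
      rw [Finset.sum_mul]
      refine Finset.sum_congr rfl fun v hv => ?_
      rw [if_neg (Finset.mem_sdiff.1 hv).2, add_zero]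
    have h2 : ∑ v ∈ U, degN G v * (S + if v ∈ U then 1 else 0).ascFactorial r
        = (S + r) * S.ascFactorial r := by
      rw [← Nat.succ_ascFactorial, hS, Finset.sum_mul]
      refine Finset.sum_congr rfl fun v hv => ?_
      rw [if_pos hv]
    rw [h1, h2, ← hsplit]
    ring
  have hterm : ∀ v ∈ Finset.range n, (degN G v : ℝ≥0∞) / ((2 * (n - 1) : ℕ) : ℝ≥0∞) *
      (((∑ i ∈ U, degN (_root_.addEdge G n v) i).ascFactorial r : ℕ) : ℝ≥0∞)
      = ((degN G v * (S + if v ∈ U then 1 else 0).ascFactorial r : ℕ) : ℝ≥0∞) *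
        ((2 * (n - 1) : ℕ) : ℝ≥0∞)⁻¹ := by
    intro v hv
    rw [h.sum_degN_addEdge hU (Finset.mem_range.1 hv), ← hS, Nat.cast_mul (degN G v), div_eq_mul_inv,
      mul_right_comm]
  rw [Finset.sum_congr rfl hterm, ← Finset.sum_mul, ← Nat.cast_sum, hnat, Nat.cast_mul,
    div_eq_mul_inv]
  ring

end HasTreeDegrees

theorem ae_hasTreeDegrees_PAlawAux {k : ℕ} {T : SimpleGraph ℕ} (hT : HasTreeDegrees k T) (m : ℕ) :
    ∀ᵐ G ∂(PAlawAux k T m), HasTreeDegrees (k + m) G := by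
  induction m with
  | zero =>
    rw [PAlawAux, ae_dirac_iff (by trivial)]
    exact hT
  | succ m ih =>
    rw [ae_iff, PAlawAux, Measure.bind_apply (by trivial) measurable_from_top.aemeasurable,
      lintegral_eq_zero_iff measurable_from_top]
    filter_upwards [ih] with G hG
    rw [Pi.zero_apply, ← lintegral_indicator_one (by trivial), hG.lintegral_paStep]
    refine Finset.sum_eq_zero fun v hv => ?_
    rw [Set.indicator_of_notMem, mul_zero]
    simpa using! hG.addEdge (Finset.mem_range.1 hv)

theorem lintegral_ascFactorial_PAlawAux {k : ℕ} {T : SimpleGraph ℕ} (hT : HasTreeDegrees k T)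
    {U : Finset ℕ} (hU : U ⊆ Finset.range k) (r m : ℕ) :
    ∫⁻ G, (((∑ i ∈ U, degN G i).ascFactorial r : ℕ) : ℝ≥0∞) ∂(PAlawAux k T m)
      = (((∑ i ∈ U, degN T i).ascFactorial r : ℕ) : ℝ≥0∞) * ∏ j ∈ Finset.range m,
        (((2 * (k + j - 1) + r : ℕ) : ℝ≥0∞) / ((2 * (k + j - 1) : ℕ) : ℝ≥0∞)) := by
  induction m with
  | zero => simp [PAlawAux, lintegral_dirac' _ measurable_from_top]
  | succ m ih =>
    rw [PAlawAux, Measure.lintegral_bind measurable_from_top.aemeasurable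
      measurable_from_top.aemeasurable, Finset.prod_range_succ, ← mul_assoc, ← ih,
      ← lintegral_mul_const _ measurable_from_top]
    refine lintegral_congr_ae ?_
    filter_upwards [ae_hasTreeDegrees_PAlawAux hT m] with G hG
    exact hG.lintegral_ascFactorial_paStep
      (hU.trans (Finset.range_subset_range.2 (Nat.le_add_right k m))) r

theorem lintegral_ascFactorial_PAlaw {k : ℕ} (hk : 2 ≤ k) {T : SimpleGraph ℕ}
    (hT : HasTreeDegrees k T) {U : Finset ℕ} (hU : U ⊆ Finset.range k) (r n : ℕ) :
    ∫⁻ G, (((∑ i ∈ U, degN G i).ascFactorial r : ℕ) : ℝ≥0∞) ∂(PAlaw k T n)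
      = ENNReal.ofReal (((∑ i ∈ U, degN T i).ascFactorial r : ℕ) * ∏ j ∈ Finset.range (n - k),
        (((k : ℝ) - 1 + r / 2 + j) / ((k : ℝ) - 1 + j))) := by
  have hk2 : (2 : ℝ) ≤ k := by exact_mod_cast hk
  have hpos : ∀ j : ℕ, (0 : ℝ) < (k : ℝ) - 1 + j := fun j => by
    have : (0 : ℝ) ≤ j := j.cast_nonneg
    linarith
  rw [PAlaw, lintegral_ascFactorial_PAlawAux hT hU, ENNReal.ofReal_mul (by positivity),
    ENNReal.ofReal_natCast, ENNReal.ofReal_prod_of_nonneg]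
  · congr 1
    refine Finset.prod_congr rfl fun j _ => ?_
    have h2 : (0 : ℝ) < ((2 * (k + j - 1) : ℕ) : ℝ) := by
      exact_mod_cast (by omega : 0 < 2 * (k + j - 1))
    rw [← ENNReal.ofReal_natCast, ← ENNReal.ofReal_natCast (2 * (k + j - 1)),
      ← ENNReal.ofReal_div_of_pos h2]
    congr 1
    have e : ((k + j - 1 : ℕ) : ℝ) = (k : ℝ) - 1 + j := by
      rw [Nat.cast_sub (by omega)]
      push_cast
      ring
    have := hpos j
    push_cast
    rw [e]
    field_simp
    ring
  · intro j _
    have := hpos j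
    have : (0 : ℝ) ≤ r := r.cast_nonneg
    exact div_nonneg (by linarith) (by linarith)

theorem isProbabilityMeasure_PAlaw {k : ℕ} (hk : 2 ≤ k) {T : SimpleGraph ℕ}
    (hT : HasTreeDegrees k T) (n : ℕ) : IsProbabilityMeasure (PAlaw k T n) := by
  constructor
  have h := lintegral_ascFactorial_PAlaw hk hT (Finset.empty_subset _) 0 n
  have hk2 : (2 : ℝ) ≤ k := by exact_mod_cast hk
  rw [Finset.prod_eq_one] at h
  · simpa using h
  · intro j _
    have : (0 : ℝ) ≤ j := j.cast_nonneg
    rw [Nat.cast_zero, zero_div, add_zero, div_self (by linarith)]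

theorem IsTreeOn.degN_eq {k : ℕ} {T : SimpleGraph ℕ} (hT : IsTreeOn k T)
    [Fintype {v : ℕ | v < k}] [DecidableRel (T.induce {v : ℕ | v < k}).Adj]
    (v : {v : ℕ | v < k}) :
    degN T v = (T.induce {v : ℕ | v < k}).degree v := by
  rw [degN, ← SimpleGraph.card_neighborSet_eq_degree, ← Nat.card_eq_fintype_card,
    Nat.card_coe_set_eq, ← Set.ncard_image_of_injective _ Subtype.val_injective]
  congr 1
  ext w
  simp only [SimpleGraph.mem_neighborSet, Set.mem_image, SimpleGraph.comap_adj, Subtype.exists,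
    Function.Embedding.subtype_apply]
  constructor
  · intro h
    exact ⟨w, (hT.1 _ _ h).2, h, rfl⟩
  · rintro ⟨x, _, h, rfl⟩
    exact h

theorem IsTreeOn.hasTreeDegrees {k : ℕ} {T : SimpleGraph ℕ} (hT : IsTreeOn k T) :
    HasTreeDegrees k T := by
  classical
  refine ⟨hT.1, ?_⟩
  have h1 := (T.induce {v : ℕ | v < k}).sum_degrees_eq_twice_card_edges
  have h2 := hT.2.card_edgeFinset
  have h3 : Fintype.card {v : ℕ | v < k} = k := by simp
  have h4 : ∑ v ∈ Finset.range k, degN T v = ∑ v : {v : ℕ | v < k}, degN T v := by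
    refine Finset.sum_subtype _ (fun x => ?_) _
    simp
  rw [h4, Finset.sum_congr rfl fun v _ => hT.degN_eq v, h1]
  omega

theorem IsTreeOn.degN_pos {k : ℕ} (hk : 2 ≤ k) {T : SimpleGraph ℕ} (hT : IsTreeOn k T) {v : ℕ}
    (hv : v < k) : 0 < degN T v := by
  classical
  have : Nontrivial {v : ℕ | v < k} :=
    ⟨⟨0, by simp; omega⟩, ⟨1, by simp; omega⟩, by simp⟩
  rw [hT.degN_eq ⟨v, hv⟩]
  exact hT.2.connected.preconnected.degree_pos_of_nontrivial _

theorem tendsto_prod_range_succ_div_rpow {a b : ℝ} (ha : 0 < a) (hb : 0 ≤ b) :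
    Tendsto (fun N : ℕ => (∏ j ∈ Finset.range (N + 1), ((a + b + j) / (a + j))) / (N : ℝ) ^ b)
      atTop (nhds (Gamma a / Gamma (a + b))) := by
  refine ((GammaSeq_tendsto_Gamma a).div (GammaSeq_tendsto_Gamma (a + b))
    (Gamma_pos_of_pos (by linarith)).ne').congr' ?_
  filter_upwards [eventually_gt_atTop 0] with N hN
  have hN' : (0 : ℝ) < N := by exact_mod_cast hN
  have h1 : ∏ j ∈ Finset.range (N + 1), (a + j) ≠ 0 :=
    Finset.prod_ne_zero_iff.2 fun j _ => by positivity
  have h2 : ∏ j ∈ Finset.range (N + 1), (a + b + j) ≠ 0 :=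
    Finset.prod_ne_zero_iff.2 fun j _ => by positivity
  have h3 : (N : ℝ) ^ a ≠ 0 := (rpow_pos_of_pos hN' _).ne'
  have h4 : (N : ℝ) ^ b ≠ 0 := (rpow_pos_of_pos hN' _).ne'
  have h5 : (N.factorial : ℝ) ≠ 0 := by positivity
  simp only [Pi.div_apply, GammaSeq, Finset.prod_div_distrib]
  rw [rpow_add hN']
  field_simp

theorem tendsto_prod_range_sub_div_sqrt_pow {a : ℝ} (ha : 0 < a) (k r : ℕ) :
    Tendsto (fun n : ℕ => (∏ j ∈ Finset.range (n - k), ((a + r / 2 + j) / (a + j))) / √n ^ r)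
      atTop (nhds (Gamma a / Gamma (a + r / 2))) := by
  have hr : (0 : ℝ) ≤ r / 2 := by positivity
  rw [← tendsto_add_atTop_iff_nat (k + 1)]
  have hratio : Tendsto (fun N : ℕ => ((N : ℝ) / (N + (k + 1 : ℕ))) ^ ((r : ℝ) / 2)) atTop
      (nhds 1) := by
    have := (tendsto_natCast_div_add_atTop ((k + 1 : ℕ) : ℝ)).rpow_const
      (p := (r : ℝ) / 2) (Or.inr hr)
    simpa using this
  have := (tendsto_prod_range_succ_div_rpow ha hr).mul hratio
  rw [mul_one] at this
  refine this.congr' ?_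
  filter_upwards [eventually_gt_atTop 0] with N hN
  have hN' : (0 : ℝ) < N := by exact_mod_cast hN
  have h4 : (N : ℝ) ^ ((r : ℝ) / 2) ≠ 0 := (rpow_pos_of_pos hN' _).ne'
  have hsqrt : √((N + (k + 1) : ℕ) : ℝ) ^ r = ((N : ℝ) + (k + 1 : ℕ)) ^ ((r : ℝ) / 2) := by
    rw [Nat.cast_add, sqrt_eq_rpow, ← rpow_natCast, ← rpow_mul (by positivity)]
    congr 1
    ring
  rw [hsqrt, div_rpow hN'.le (by positivity), show N + (k + 1) - k = N + 1 by omega]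
  field_simp

theorem cast_ascFactorial_eq_Gamma_div {d : ℕ} (hd : 1 ≤ d) (r : ℕ) :
    (d.ascFactorial r : ℝ) = Gamma (d + r) / Gamma d := by
  have hd0 : (0 : ℝ) < d := by exact_mod_cast hd
  have hG := (Gamma_pos_of_pos hd0).ne'
  induction r with
  | zero => simp [div_self hG]
  | succ r ih =>
    rw [Nat.ascFactorial_succ, Nat.cast_mul, ih, Nat.cast_succ, ← add_assoc,
      Gamma_add_one (by positivity)]
    push_cast
    ring

theorem ascFactorial_sq_le (s r : ℕ) : s.ascFactorial r ^ 2 ≤ s.ascFactorial (2 * r) := by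
  rw [two_mul, ← Nat.ascFactorial_mul_ascFactorial, sq]
  exact Nat.mul_le_mul_left _ (Nat.ascFactorial_le r (Nat.le_add_right s r))

theorem tendsto_ascFactorial_div_sqrt_pow {s : ℕ → ℕ} {x : ℝ}
    (h : Tendsto (fun n : ℕ => (s n : ℝ) / √n) atTop (nhds x)) (r : ℕ) :
    Tendsto (fun n : ℕ => ((s n).ascFactorial r : ℝ) / √n ^ r) atTop (nhds (x ^ r)) := by
  have hsqrt : Tendsto (fun n : ℕ => √(n : ℝ)) atTop atTop :=
    tendsto_sqrt_atTop.comp tendsto_natCast_atTop_atTop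
  induction r with
  | zero => simp
  | succ r ih =>
    have hr : Tendsto (fun n : ℕ => (r : ℝ) / √(n : ℝ)) atTop (nhds 0) :=
      hsqrt.const_div_atTop _
    have := ih.mul (h.add hr)
    rw [add_zero, ← pow_succ] at this
    refine this.congr fun n => ?_
    rw [Nat.ascFactorial_succ, pow_succ, ← add_div, div_mul_div_comm]
    push_cast
    ring

theorem aemeasurable_of_map_eq_PAlaw {k : ℕ} (hk : 2 ≤ k) {T : SimpleGraph ℕ}
    (hT : HasTreeDegrees k T) {Ω : Type*} [MeasurableSpace Ω] {P : Measure Ω} {n : ℕ}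
    {X : Ω → SimpleGraph ℕ} (hX : P.map X = PAlaw k T n) : AEMeasurable X P := by
  by_contra h
  rw [Measure.map_of_not_aemeasurable h] at hX
  have := isProbabilityMeasure_PAlaw hk hT n
  exact IsProbabilityMeasure.ne_zero (PAlaw k T n) hX.symm

theorem integral_ascFactorial_of_map_eq_PAlaw {k : ℕ} (hk : 2 ≤ k) {T : SimpleGraph ℕ}
    (hT : HasTreeDegrees k T) {U : Finset ℕ} (hU : U ⊆ Finset.range k) {Ω : Type*}
    [MeasurableSpace Ω] {P : Measure Ω} {n : ℕ} {X : Ω → SimpleGraph ℕ}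
    (hX : P.map X = PAlaw k T n) (r : ℕ) :
    Integrable (fun ω => ((∑ i ∈ U, degN (X ω) i).ascFactorial r : ℝ)) P ∧
      ∫ ω, ((∑ i ∈ U, degN (X ω) i).ascFactorial r : ℝ) ∂P
        = (∑ i ∈ U, degN T i).ascFactorial r * ∏ j ∈ Finset.range (n - k),
          (((k : ℝ) - 1 + r / 2 + j) / ((k : ℝ) - 1 + j)) := by
  have hXm := aemeasurable_of_map_eq_PAlaw hk hT hX
  have hm : AEStronglyMeasurable
      (fun ω => ((∑ i ∈ U, degN (X ω) i).ascFactorial r : ℝ)) P :=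
    ((measurable_from_top (f := fun G : SimpleGraph ℕ =>
      ((∑ i ∈ U, degN G i).ascFactorial r : ℝ))).comp_aemeasurable hXm).aestronglyMeasurable
  have h0 : 0 ≤ᵐ[P] fun ω => ((∑ i ∈ U, degN (X ω) i).ascFactorial r : ℝ) :=
    Eventually.of_forall fun ω => Nat.cast_nonneg _
  have hl := lintegral_ascFactorial_PAlaw hk hT hU r n
  rw [← hX, lintegral_map' measurable_from_top.aemeasurable hXm] at hl
  simp only [← ENNReal.ofReal_natCast] at hl
  constructor
  · rw [← lintegral_ofReal_ne_top_iff_integrable hm h0, hl]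
    exact ENNReal.ofReal_ne_top
  · rw [integral_eq_lintegral_of_nonneg_ae h0 hm, hl, ENNReal.toReal_ofReal]
    have hk2 : (2 : ℝ) ≤ k := by exact_mod_cast hk
    refine mul_nonneg (Nat.cast_nonneg _) (Finset.prod_nonneg fun j _ => ?_)
    have : (0 : ℝ) ≤ j := j.cast_nonneg
    have : (0 : ℝ) ≤ r := r.cast_nonneg
    exact div_nonneg (by linarith) (by linarith)

/-- The moments of the almost sure limit of the rescaled total degree of `U`. -/
theorem integral_limit_pow {k : ℕ} (hk : 2 ≤ k) {T : SimpleGraph ℕ}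
    (hT : HasTreeDegrees k T) {U : Finset ℕ} (hU : U ⊆ Finset.range k)
    (hd : 1 ≤ ∑ i ∈ U, degN T i) {Ω : Type*} [MeasurableSpace Ω] {P : Measure Ω}
    [IsProbabilityMeasure P] {X : ℕ → Ω → SimpleGraph ℕ}
    (hX : ∀ n : ℕ, k ≤ n → P.map (X n) = PAlaw k T n) {Y : Ω → ℝ}
    (hY : ∀ᵐ ω ∂P, Tendsto (fun n : ℕ => ((∑ i ∈ U, degN (X n ω) i : ℕ) : ℝ) / √n) atTop
      (nhds (Y ω))) (r : ℕ) :
    Integrable (fun ω => Y ω ^ r) P ∧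
      ∫ ω, Y ω ^ r ∂P = limitMoment k (∑ i ∈ U, degN T i) r := by
  have hk1 : (0 : ℝ) < (k : ℝ) - 1 := by
    have : (2 : ℝ) ≤ k := by exact_mod_cast hk
    linarith
  set S : ℕ → Ω → ℕ := fun n ω => ∑ i ∈ U, degN (X n ω) i with hS
  have hInt : ∀ n r, Integrable (fun ω => ((S (n + k) ω).ascFactorial r : ℝ)) P := fun n r =>
    (integral_ascFactorial_of_map_eq_PAlaw hk hT hU (hX _ (Nat.le_add_left k n)) r).1
  have hlim : ∀ r : ℕ, Tendsto (fun n : ℕ =>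
      ∫ ω, ((S (n + k) ω).ascFactorial r : ℝ) / √(n + k : ℕ) ^ r ∂P) atTop
      (nhds (limitMoment k (∑ i ∈ U, degN T i) r)) := by
    intro r
    have := (((tendsto_prod_range_sub_div_sqrt_pow hk1 k r).comp
      (tendsto_add_atTop_nat k)).const_mul ((∑ i ∈ U, degN T i).ascFactorial r : ℝ))
    rw [cast_ascFactorial_eq_Gamma_div hd, div_mul_div_comm] at this
    refine this.congr fun n => ?_
    rw [integral_div,
      (integral_ascFactorial_of_map_eq_PAlaw hk hT hU (hX _ (Nat.le_add_left k n)) r).2,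
      cast_ascFactorial_eq_Gamma_div hd, Function.comp_apply, mul_div_assoc]
  obtain ⟨C, hC⟩ := (hlim (2 * r)).bddAbove_range
  have hsq_le : ∀ n ω, (((S (n + k) ω).ascFactorial r : ℝ) / √(n + k : ℕ) ^ r) ^ 2
      ≤ ((S (n + k) ω).ascFactorial (2 * r) : ℝ) / √(n + k : ℕ) ^ (2 * r) := by
    intro n ω
    rw [div_pow, ← pow_mul, mul_comm r 2]
    gcongr
    exact_mod_cast ascFactorial_sq_le _ _
  have hsq : ∀ n, Integrable
      (fun ω => (((S (n + k) ω).ascFactorial r : ℝ) / √(n + k : ℕ) ^ r) ^ 2) P := by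
    intro n
    refine ((hInt n (2 * r)).div_const (√(n + k : ℕ) ^ (2 * r))).mono'
      (((hInt n r).div_const _).aestronglyMeasurable.pow 2) (Eventually.of_forall fun ω => ?_)
    rw [norm_of_nonneg (sq_nonneg _)]
    exact hsq_le n ω
  obtain ⟨h1, h2⟩ := tendsto_integral_of_ae_tendsto_of_sq_bounded (P := P) (C := C)
    (f := fun n ω => ((S (n + k) ω).ascFactorial r : ℝ) / √(n + k : ℕ) ^ r)
    (g := fun ω => Y ω ^ r) (fun n => ((hInt n r).div_const _).aemeasurable) hsq
    (fun n => (integral_mono (hsq n) ((hInt n (2 * r)).div_const _) (hsq_le n)).trans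
      (hC ⟨n, rfl⟩))
    (by
      filter_upwards [hY] with ω hω
      exact (tendsto_ascFactorial_div_sqrt_pow hω r).comp (tendsto_add_atTop_nat k))
  exact ⟨h1, tendsto_nhds_unique h2 (hlim r)⟩

/-- The law of the almost sure limit of the rescaled total degree of `U`. -/
theorem map_limit_eq_of_isLimitLaw {k : ℕ} (hk : 2 ≤ k) {T : SimpleGraph ℕ}
    (hT : HasTreeDegrees k T) {U : Finset ℕ} (hU : U ⊆ Finset.range k)
    (hd : 1 ≤ ∑ i ∈ U, degN T i) {Ω : Type*} [MeasurableSpace Ω] {P : Measure Ω}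
    [IsProbabilityMeasure P] {X : ℕ → Ω → SimpleGraph ℕ}
    (hX : ∀ n : ℕ, k ≤ n → P.map (X n) = PAlaw k T n) {Y : Ω → ℝ}
    (hY : ∀ᵐ ω ∂P, Tendsto (fun n : ℕ => ((∑ i ∈ U, degN (X n ω) i : ℕ) : ℝ) / √n) atTop
      (nhds (Y ω))) {ν : Measure ℝ} (hν : IsLimitLaw k (∑ i ∈ U, degN T i) ν) :
    AEMeasurable Y P ∧ P.map Y = ν := by
  have hmom := integral_limit_pow hk hT hU hd hX hY
  have hYm : AEMeasurable Y P := by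
    simpa using (hmom 1).1.aemeasurable
  have := hν.prob
  have := Measure.isProbabilityMeasure_map hYm
  have hpow : ∀ r : ℕ, AEStronglyMeasurable (fun x : ℝ => x ^ r) (P.map Y) := fun r =>
    (measurable_id.pow_const r).aestronglyMeasurable
  refine ⟨hYm, measure_eq_of_moments_eq ?_ hν.nonneg (fun r => ?_) hν.integrable_exp fun r => ?_⟩
  · rw [ae_map_iff hYm measurableSet_Ici]
    filter_upwards [hY] with ω hω
    exact ge_of_tendsto' hω fun n => by positivity
  · rw [integrable_map_measure (hpow r) hYm]
    exact (hmom r).1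
  · rw [integral_map hYm (hpow r), (hmom r).2, hν.integral_pow]

/-- Tail asymptotics for sums of limiting rescaled degrees of seed vertices:
if `T` is a seed tree on `k ≥ 2` vertices, `U` a nonempty set of seed vertices and
`d = ∑_{i ∈ U} d_T(i)`, then
`P(∑_{i ∈ U} D_i(T) > t) ∼ c(k, d) t^(1-2k+2d) exp(-t²/4)` as `t → ∞`.
Here `D_i(T)` is the a.s. limit of `deg_{PA(n,T)}(i)/√n`, and `X n` is a realization of
the preferential attachment process started at `T`. -/
theorem tail_sum_limit_degrees_seed
    (k : ℕ) (hk : 2 ≤ k) (T : SimpleGraph ℕ) (hT : IsTreeOn k T)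
    {Ω : Type} [MeasurableSpace Ω] (P : Measure Ω) [IsProbabilityMeasure P]
    (X : ℕ → Ω → SimpleGraph ℕ)
    (hX : ∀ n : ℕ, k ≤ n → P.map (X n) = PAlaw k T n)
    (D : ℕ → Ω → ℝ)
    (hD : ∀ i : ℕ, ∀ᵐ ω ∂P,
      Filter.Tendsto (fun n : ℕ => (degN (X n ω) i : ℝ) / Real.sqrt n)
        Filter.atTop (nhds (D i ω)))
    (U : Finset ℕ) (hU : U.Nonempty) (hUk : U ⊆ Finset.range k)
    (d : ℕ) (hd : d = ∑ i ∈ U, degN T i) :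
    Filter.Tendsto (fun t : ℝ =>
        (P {ω | t < ∑ i ∈ U, D i ω}).toReal /
          (cconst (k : ℝ) (d : ℝ) * t ^ ((1 : ℝ) - 2 * k + 2 * d) * Real.exp (-t ^ 2 / 4)))
      Filter.atTop (nhds 1) := by
  have hTd := hT.hasTreeDegrees
  have hd1 : 1 ≤ ∑ i ∈ U, degN T i :=
    Finset.sum_pos (fun i hi => hT.degN_pos hk (Finset.mem_range.1 (hUk hi))) hU
  have hdk : ∑ i ∈ U, degN T i ≤ 2 * k - 2 := by
    have := Finset.sum_le_sum_of_subset (f := degN T) hUk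
    rw [hTd.sum_degN] at this
    omega
  obtain ⟨ν, hν⟩ := exists_isLimitLaw hk hd1 hdk
  have hsum : ∀ᵐ ω ∂P, Tendsto (fun n : ℕ => ((∑ i ∈ U, degN (X n ω) i : ℕ) : ℝ) / √n) atTop
      (nhds (∑ i ∈ U, D i ω)) := by
    filter_upwards [ae_all_iff.2 hD] with ω hω
    refine (tendsto_finsetSum U fun i _ => hω i).congr fun n => ?_
    rw [Nat.cast_sum, Finset.sum_div]
  obtain ⟨hm, hmap⟩ := map_limit_eq_of_isLimitLaw hk hTd hUk hd1 hX hsum hν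
  rw [hd]
  refine hν.tail.congr fun t => ?_
  rw [← hmap, measureReal_def, Measure.map_apply_of_aemeasurable hm measurableSet_Ioi]
  rfl

end
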